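/- arXiv:1901.10315 — 2 statements merged into one kernel-verified Lean document; each statement's English description precedes it below -/
import Mathlib

section
/- Lower bound for the full period at low energy: for every η with 1 < η ≤ 1.38, letting k_min(η) ∈ (0,1) and k_max(η) > 1 be the two solutions of V(k) = η, one has ∫_{k_min(η)}^{k_max(η)} 2·(η − V(k))^{−1/2} dk > 1.3194·π. (This integral is the period T(c) of change of polar angle of the closed Abresch–Langer trajectory of energy c = e^{(η−1)/2}.) -/
open Real

noncomputable def V (k : ℝ) : ℝ := k ^ 2 - 2 * Real.log k

open Set MeasureTheory in
lemma nonneg_of_deriv_sign_change {F F' : ℝ → ℝ} {l c r : ℝ} (hlc : l < c) (hcr : c < r)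
    (hd : ∀ x ∈ Ioo l r, HasDerivAt F (F' x) x)
    (hneg : ∀ x ∈ Ioo l c, F' x ≤ 0) (hpos : ∀ x ∈ Ioo c r, 0 ≤ F' x) (hc : F c = 0)
    {x : ℝ} (hx : x ∈ Ioo l r) : 0 ≤ F x := by
  rcases le_total x c with h | h
  · have hanti : AntitoneOn F (Icc x c) := by
      apply antitoneOn_of_hasDerivWithinAt_nonpos (f' := F') (convex_Icc x c)
      · exact fun y hy =>
        (hd y ⟨by linarith [hx.1, hy.1], by linarith [hy.2]⟩).continuousAt.continuousWithinAt
      · intro y hy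
        rw [interior_Icc] at hy
        exact (hd y ⟨by linarith [hx.1, hy.1], by linarith [hy.2]⟩).hasDerivWithinAt
      · intro y hy
        rw [interior_Icc] at hy
        exact hneg y ⟨by linarith [hx.1, hy.1], hy.2⟩
    simpa [hc] using hanti (left_mem_Icc.2 h) (right_mem_Icc.2 h) h
  · have hmono : MonotoneOn F (Icc c x) := by
      apply monotoneOn_of_hasDerivWithinAt_nonneg (f' := F') (convex_Icc c x)
      · exact fun y hy =>
        (hd y ⟨by linarith [hy.1], by linarith [hx.2, hy.2]⟩).continuousAt.continuousWithinAt
      · intro y hy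
        rw [interior_Icc] at hy
        exact (hd y ⟨by linarith [hy.1], by linarith [hx.2, hy.2]⟩).hasDerivWithinAt
      · intro y hy
        rw [interior_Icc] at hy
        exact hpos y ⟨hy.1, by linarith [hx.2, hy.2]⟩
    simpa [hc] using hmono (left_mem_Icc.2 h) (right_mem_Icc.2 h) h

lemma V_one : V 1 = 1 := by simp [V]

lemma hasDerivAt_V {k : ℝ} (hk : 0 < k) : HasDerivAt V (2 * (k - 1 / k)) k := by
  have h := (hasDerivAt_pow 2 k).sub ((Real.hasDerivAt_log hk.ne').const_mul 2)
  refine h.congr_deriv ?_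
  field_simp
  push_cast
  ring

lemma sub_one_div_neg {k : ℝ} (h0 : 0 < k) (h1 : k < 1) : k - 1 / k < 0 := by
  have := one_lt_one_div h0 h1
  linarith

lemma sub_one_div_pos {k : ℝ} (h1 : 1 < k) : 0 < k - 1 / k := by
  have : 1 / k < 1 := by rw [div_lt_one (by linarith)]; exact h1
  linarith

open Set in
lemma strictAntiOn_V : StrictAntiOn V (Ioc 0 1) := by
  apply strictAntiOn_of_hasDerivWithinAt_neg (f' := fun k => 2 * (k - 1 / k)) (convex_Ioc 0 1)
  · exact fun y hy => (hasDerivAt_V hy.1).continuousAt.continuousWithinAt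
  · intro y hy
    rw [interior_Ioc] at hy
    exact (hasDerivAt_V hy.1).hasDerivWithinAt
  · intro y hy
    rw [interior_Ioc] at hy
    linarith [sub_one_div_neg hy.1 hy.2]

open Set in
lemma strictMonoOn_V : StrictMonoOn V (Ici 1) := by
  apply strictMonoOn_of_hasDerivWithinAt_pos (f' := fun k => 2 * (k - 1 / k)) (convex_Ici 1)
  · exact fun y hy => (hasDerivAt_V (zero_lt_one.trans_le hy)).continuousAt.continuousWithinAt
  · intro y hy
    rw [interior_Ici] at hy
    exact (hasDerivAt_V (zero_lt_one.trans hy)).hasDerivWithinAt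
  · intro y hy
    rw [interior_Ici] at hy
    linarith [sub_one_div_pos hy]

lemma lt_V_three_fifths : 1.38 < V 0.6 := by
  have h : Real.log 0.6 < -0.51 := by
    rw [Real.log_lt_iff_lt_exp (by norm_num), Real.exp_neg, lt_inv_comm₀ (by norm_num) (exp_pos _)]
    refine (Real.exp_bound' (by norm_num) (by norm_num) (n := 5) (by norm_num)).trans_lt ?_
    norm_num [Finset.sum_range_succ, Nat.factorial]
  unfold V
  linarith

lemma lt_V_147 : 1.38 < V 1.47 := by
  have h : Real.log 1.47 < 0.39 := by
    rw [Real.log_lt_iff_lt_exp (by norm_num)]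
    refine lt_of_lt_of_le ?_ (Real.sum_le_exp_of_nonneg (by norm_num) 5)
    norm_num [Finset.sum_range_succ, Nat.factorial]
  unfold V
  linarith

lemma hasDerivAt_sub_one_div {k : ℝ} (hk : 0 < k) :
    HasDerivAt (fun x : ℝ => x - 1 / x) (1 + 1 / k ^ 2) k := by
  have h := (hasDerivAt_id k).sub (hasDerivAt_inv hk.ne')
  simp only [one_div]
  refine h.congr_deriv ?_
  ring

open Set in
lemma V_sub_one_le {k : ℝ} (hk : 0 < k) : V k - 1 ≤ (k - 1 / k) ^ 2 := by
  have key : 0 ≤ (k - 1 / k) ^ 2 - (V k - 1) := by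
    apply nonneg_of_deriv_sign_change (F := fun k => (k - 1 / k) ^ 2 - (V k - 1))
      (F' := fun k => 2 * (k - 1 / k) * (1 / k ^ 2)) (l := 0) (c := 1) (r := k + 2)
      zero_lt_one (by linarith) _ _ _ (by simp [V_one]) ⟨hk, by linarith⟩
    · intro x hx
      refine (((hasDerivAt_sub_one_div hx.1).pow 2).sub
        ((hasDerivAt_V hx.1).sub_const 1)).congr_deriv ?_
      push_cast
      ring
    · intro x hx
      have := sub_one_div_neg hx.1 hx.2
      exact mul_nonpos_of_nonpos_of_nonneg (by linarith) (by positivity)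
    · intro x hx
      have := sub_one_div_pos hx.1
      positivity
  linarith

lemma sextic_nonneg {k : ℝ} (h₁ : 0.6 ≤ k) (h₂ : k ≤ 1.47) :
    0 ≤ (2 * k - 0.345 * (k ^ 2 - 1)) ^ 3 - 2 * 1.32 ^ 2 * (k * (k ^ 2 + 1)) := by
  obtain ⟨a, ha⟩ : ∃ a, a = k - 0.6 := ⟨_, rfl⟩
  have ha0 : 0 ≤ a := by linarith
  obtain ⟨b, hb⟩ : ∃ b, b = 1.47 - k := ⟨_, rfl⟩
  have hb0 : 0 ≤ b := by linarith
  have e0 : 0 ≤ b ^ 6 := by positivity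
  have e1 : 0 ≤ a * b ^ 5 := by positivity
  have e2 : 0 ≤ a ^ 2 * b ^ 4 := by positivity
  have e3 : 0 ≤ a ^ 3 * b ^ 3 := by positivity
  have e4 : 0 ≤ a ^ 4 * b ^ 2 := by positivity
  have e5 : 0 ≤ a ^ 5 * b := by positivity
  have e6 : 0 ≤ a ^ 6 := by positivity
  subst ha hb
  ring_nf at e0 e1 e2 e3 e4 e5 e6 ⊢
  linarith

lemma two_sub_pos {k : ℝ} (h₁ : 0.6 < k) (h₂ : k < 1.47) : 0 < 2 - 0.345 * (k - 1 / k) := by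
  have : 0 < 1 / k := by positivity
  linarith

open Set in
lemma sq_le_V_sub_one {k : ℝ} (h₁ : 0.6 < k) (h₂ : k < 1.47) :
    (1.32 * (k - 1 / k) / (2 - 0.345 * (k - 1 / k))) ^ 2 ≤ V k - 1 := by
  have hfac : ∀ x ∈ Ioo (0.6 : ℝ) 1.47,
      0 ≤ 1 - 2 * 1.32 ^ 2 * (1 + 1 / x ^ 2) / (2 - 0.345 * (x - 1 / x)) ^ 3 := by
    intro x hx
    have hx0 : 0 < x := by linarith [hx.1]
    have hd := two_sub_pos hx.1 hx.2
    rw [sub_nonneg, div_le_one (by positivity)]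
    have h := sextic_nonneg hx.1.le hx.2.le
    have e : (2 - 0.345 * (x - 1 / x)) ^ 3 - 2 * 1.32 ^ 2 * (1 + 1 / x ^ 2)
        = ((2 * x - 0.345 * (x ^ 2 - 1)) ^ 3 - 2 * 1.32 ^ 2 * (x * (x ^ 2 + 1))) / x ^ 3 := by
      field_simp
    have : 0 ≤ ((2 * x - 0.345 * (x ^ 2 - 1)) ^ 3 - 2 * 1.32 ^ 2 * (x * (x ^ 2 + 1))) / x ^ 3 := by
      positivity
    linarith
  have key : 0 ≤ V k - 1 - (1.32 * (k - 1 / k) / (2 - 0.345 * (k - 1 / k))) ^ 2 := by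
    apply nonneg_of_deriv_sign_change
      (F := fun k => V k - 1 - (1.32 * (k - 1 / k) / (2 - 0.345 * (k - 1 / k))) ^ 2)
      (F' := fun x => 2 * (x - 1 / x) *
        (1 - 2 * 1.32 ^ 2 * (1 + 1 / x ^ 2) / (2 - 0.345 * (x - 1 / x)) ^ 3))
      (l := 0.6) (c := 1) (r := 1.47) (by norm_num) (by norm_num) _ _ _
      (by simp [V_one]) ⟨h₁, h₂⟩
    · intro x hx
      have hx0 : 0 < x := by linarith [hx.1]
      have hd := two_sub_pos hx.1 hx.2
      have hu := hasDerivAt_sub_one_div hx0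
      refine (((hasDerivAt_V hx0).sub_const 1).sub (((hu.const_mul 1.32).div
        ((hu.const_mul 0.345).const_sub 2) hd.ne').pow 2)).congr_deriv ?_
      simp only [Pi.div_apply]
      generalize x - 1 / x = u at *
      generalize 1 + 1 / x ^ 2 = w at *
      push_cast
      field_simp
      ring
    · intro x hx
      have := sub_one_div_neg (by linarith [hx.1]) hx.2
      exact mul_nonpos_of_nonpos_of_nonneg (by linarith) (hfac x ⟨hx.1, by linarith [hx.2]⟩)
    · intro x hx
      have := sub_one_div_pos hx.1
      exact mul_nonneg (by linarith) (hfac x ⟨by linarith [hx.1], hx.2⟩)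
  linarith

lemma hasDerivAt_arcsin_sqrt_V {η k : ℝ} (hk : 0 < k) (h₁ : 1 < V k) (h₂ : V k < η) :
    HasDerivAt (fun x => arcsin (√(V x - 1) / √(η - 1)))
      ((k - 1 / k) / √(V k - 1) / √(η - V k)) k := by
  have hs : 0 < √(V k - 1) := sqrt_pos.2 (by linarith)
  have hr : 0 < √(η - V k) := sqrt_pos.2 (by linarith)
  have hd : 0 < √(η - 1) := sqrt_pos.2 (by linarith)
  have hs2 := sq_sqrt (show 0 ≤ V k - 1 by linarith)
  have hr2 := sq_sqrt (show 0 ≤ η - V k by linarith)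
  have hd2 := sq_sqrt (show 0 ≤ η - 1 by linarith)
  have hlt : √(V k - 1) / √(η - 1) < 1 := by
    rw [div_lt_one hd]
    exact sqrt_lt_sqrt (by linarith) (by linarith)
  have hnn : 0 < √(V k - 1) / √(η - 1) := by positivity
  have h := (hasDerivAt_arcsin (by linarith) hlt.ne).comp k
    ((((hasDerivAt_V hk).sub_const 1).sqrt (by linarith)).div_const √(η - 1))
  refine h.congr_deriv ?_
  have e : √(1 - (√(V k - 1) / √(η - 1)) ^ 2) = √(η - V k) / √(η - 1) := by
    rw [← sqrt_sq (show 0 ≤ √(η - V k) / √(η - 1) by positivity)]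
    congr 1
    rw [div_pow, div_pow, hs2, hr2, hd2]
    have : η - 1 ≠ 0 := by linarith
    field_simp
    ring
  rw [e]
  field_simp

lemma hasDerivAt_sqrt_sub_V {η k : ℝ} (hk : 0 < k) (h₂ : V k < η) :
    HasDerivAt (fun x => √(η - V x)) (-(k - 1 / k) / √(η - V k)) k := by
  refine (((hasDerivAt_V hk).const_sub η).sqrt (by linarith)).congr_deriv ?_
  have hr : 0 < √(η - V k) := sqrt_pos.2 (by linarith)
  field_simp

open Set MeasureTheory in
/-- On an interval where `V` is monotone (increasing for `σ = 1`, decreasing for `σ = -1`), the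
period integrand dominates the derivative of an explicit function. -/
lemma intervalIntegrable_and_sub_le_integral {η l r σ : ℝ} (hlr : l ≤ r) (hl : 0.6 < l)
    (hr : r < 1.47) (hσ : σ ^ 2 = 1) (hu : ∀ k ∈ Ioo l r, 0 < σ * (k - 1 / k))
    (hV : ∀ k ∈ Ioo l r, 1 < V k ∧ V k < η) :
    IntervalIntegrable (fun k => 2 * (√(η - V k))⁻¹) volume l r ∧
    (1.32 * (σ * arcsin (√(V r - 1) / √(η - 1))) - 0.345 * √(η - V r)) -
      (1.32 * (σ * arcsin (√(V l - 1) / √(η - 1))) - 0.345 * √(η - V l)) ≤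
      ∫ k in l..r, 2 * (√(η - V k))⁻¹ := by
  have hpos : ∀ k ∈ Icc l r, 0 < k := fun k hk => by linarith [hk.1]
  have hVc : ContinuousOn V (Icc l r) := fun k hk =>
    (hasDerivAt_V (hpos k hk)).continuousAt.continuousWithinAt
  have hAc : ContinuousOn (fun x => arcsin (√(V x - 1) / √(η - 1))) (Icc l r) :=
    continuous_arcsin.comp_continuousOn ((hVc.sub continuousOn_const).sqrt.div_const _)
  have hBc : ContinuousOn (fun x => √(η - V x)) (Icc l r) := (continuousOn_const.sub hVc).sqrt
  have hA : ∀ k ∈ Ioo l r, HasDerivAt (fun x => σ * arcsin (√(V x - 1) / √(η - 1)))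
      (σ * ((k - 1 / k) / √(V k - 1) / √(η - V k))) k := fun k hk =>
    (hasDerivAt_arcsin_sqrt_V (hpos k (Ioo_subset_Icc_self hk)) (hV k hk).1 (hV k hk).2).const_mul σ
  have hlow : ∀ k ∈ Ioo l r, (√(η - V k))⁻¹ ≤ σ * ((k - 1 / k) / √(V k - 1) / √(η - V k)) := by
    intro k hk
    have hs : 0 < √(V k - 1) := sqrt_pos.2 (by linarith [(hV k hk).1])
    have hr : 0 < √(η - V k) := sqrt_pos.2 (by linarith [(hV k hk).2])
    have h : √(V k - 1) ≤ σ * (k - 1 / k) := by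
      refine (sqrt_le_left (hu k hk).le).2 ?_
      rw [mul_pow, hσ, one_mul]
      exact V_sub_one_le (hpos k (Ioo_subset_Icc_self hk))
    rw [← mul_div_assoc, ← mul_div_assoc, inv_eq_one_div]
    gcongr
    exact (one_le_div hs).2 h
  have hint : IntegrableOn (fun k => 2 * (√(η - V k))⁻¹) (Ioc l r) := by
    have hA' : IntegrableOn (fun k => σ * ((k - 1 / k) / √(V k - 1) / √(η - V k))) (Ioo l r) :=
      (intervalIntegral.integrableOn_deriv_of_nonneg (hAc.const_mul σ) hA
        fun k hk => (inv_nonneg.2 (sqrt_nonneg _)).trans (hlow k hk)).mono_set Ioo_subset_Ioc_self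
    have hm : Measurable V := by unfold V; fun_prop
    rw [integrableOn_Ioc_iff_integrableOn_Ioo]
    refine (hA'.const_mul 2).mono' (by fun_prop) ?_
    refine (ae_restrict_iff' measurableSet_Ioo).2 (Filter.Eventually.of_forall fun k hk => ?_)
    rw [norm_of_nonneg (by positivity)]
    linarith [hlow k hk]
  refine ⟨(intervalIntegrable_iff_integrableOn_Ioc_of_le hlr).2 hint, ?_⟩
  apply intervalIntegral.sub_le_integral_of_hasDeriv_right_of_le
    (g := fun x => 1.32 * (σ * arcsin (√(V x - 1) / √(η - 1))) - 0.345 * √(η - V x))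
    (g' := fun k => 1.32 * (σ * ((k - 1 / k) / √(V k - 1) / √(η - V k))) -
      0.345 * (-(k - 1 / k) / √(η - V k))) hlr
  · exact ((hAc.const_mul σ).const_mul _).sub (hBc.const_mul _)
  · exact fun k hk => (((hA k hk).const_mul _).sub ((hasDerivAt_sqrt_sub_V
      (hpos k (Ioo_subset_Icc_self hk)) (hV k hk).2).const_mul _)).hasDerivWithinAt
  · rwa [integrableOn_Icc_iff_integrableOn_Ioc]
  · intro k hk
    have hk' : 0.6 < k ∧ k < 1.47 := ⟨by linarith [hk.1], by linarith [hk.2]⟩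
    have hs : 0 < √(V k - 1) := sqrt_pos.2 (by linarith [(hV k hk).1])
    have hr : 0 < √(η - V k) := sqrt_pos.2 (by linarith [(hV k hk).2])
    have hd := two_sub_pos hk'.1 hk'.2
    have h : 1.32 * (σ * (k - 1 / k)) / (2 - 0.345 * (k - 1 / k)) ≤ √(V k - 1) := by
      apply le_sqrt_of_sq_le
      convert sq_le_V_sub_one hk'.1 hk'.2 using 1
      rw [div_pow, div_pow, mul_pow, mul_pow, mul_pow, hσ, one_mul]
    rw [div_le_iff₀ hd, mul_comm √(V k - 1), ← div_le_iff₀ hs] at h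
    calc _ = (1.32 * (σ * (k - 1 / k)) / √(V k - 1) + 0.345 * (k - 1 / k)) * (√(η - V k))⁻¹ := by
          ring
      _ ≤ _ := by gcongr; linarith

theorem stmt_11 (kmin kmax : ℝ → ℝ)
    (hkmin : ∀ η : ℝ, 1 < η → 0 < kmin η ∧ kmin η < 1 ∧ V (kmin η) = η)
    (hkmax : ∀ η : ℝ, 1 < η → 1 < kmax η ∧ V (kmax η) = η)
    (η : ℝ) (hη : 1 < η) (hη' : η ≤ 1.38) :
    (∫ k in (kmin η)..(kmax η), 2 * (Real.sqrt (η - V k))⁻¹) > 1.3194 * π := by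
  obtain ⟨ha0, ha1, hVa⟩ := hkmin η hη
  obtain ⟨hb1, hVb⟩ := hkmax η hη
  generalize kmin η = a at *
  generalize kmax η = b at *
  have ha : 0.6 < a := by
    by_contra! h
    have := strictAntiOn_V.antitoneOn ⟨ha0, ha1.le⟩ ⟨by norm_num, by norm_num⟩ h
    linarith [lt_V_three_fifths]
  have hb : b < 1.47 := by
    by_contra! h
    have := strictMonoOn_V.monotoneOn (Set.mem_Ici.2 (by norm_num)) (Set.mem_Ici.2 hb1.le) h
    linarith [lt_V_147]
  obtain ⟨hi₁, hl₁⟩ := intervalIntegrable_and_sub_le_integral (η := η) (σ := -1) ha1.le ha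
    (by norm_num) (by norm_num)
    (fun k hk => by linarith [sub_one_div_neg (by linarith [hk.1]) hk.2])
    (fun k hk => by
      have hk0 : 0 < k := by linarith [hk.1]
      have h1 := strictAntiOn_V ⟨hk0, hk.2.le⟩ ⟨zero_lt_one, le_rfl⟩ hk.2
      have h2 := strictAntiOn_V ⟨ha0, ha1.le⟩ ⟨hk0, hk.2.le⟩ hk.1
      rw [V_one] at h1
      exact ⟨h1, by linarith⟩)
  obtain ⟨hi₂, hl₂⟩ := intervalIntegrable_and_sub_le_integral (η := η) (σ := 1) hb1.le
    (by norm_num) hb (by norm_num)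
    (fun k hk => by linarith [sub_one_div_pos hk.1])
    (fun k hk => by
      have h1 := strictMonoOn_V (Set.mem_Ici.2 le_rfl) (Set.mem_Ici.2 hk.1.le) hk.1
      have h2 := strictMonoOn_V (Set.mem_Ici.2 hk.1.le) (Set.mem_Ici.2 hb1.le) hk.2
      rw [V_one] at h1
      exact ⟨h1, by linarith⟩)
  rw [← intervalIntegral.integral_add_adjacent_intervals hi₁ hi₂]
  have hd : √(η - 1) ≠ 0 := (sqrt_pos.2 (by linarith)).ne'
  simp only [hVa, hVb, V_one, sub_self, sqrt_zero, zero_div, arcsin_zero, div_self hd,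
    arcsin_one] at hl₁ hl₂
  linarith [pi_pos]
end

section
/- For every c ≥ e^{0.15325} (i.e. c ≥ e^{(1.3065−1)/2}), setting η = 1 + 2·log c, one has ∫_{k_min(η)}^{k_A(η)} 2·(η − V(k))^{−1/2} dk + 2·∫_{1/c}^{k_A(η)} (η − V(k))^{−1/2} dk + 2·arcsin(1/c) − π/3 > π. (The left-hand side equals h₁(c) + 2h₂(c) + 2·Δθ_{NA}(c), where Δθ_{NA}(c) is the change of polar angle from the lowest point N to the point A of the Abresch–Langer trajectory of energy c.) -/
open Real

open Set MeasureTheory intervalIntegral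

lemma concaveOn_sub_V (η : ℝ) : ConcaveOn ℝ (Ioi 0) (fun k => η - V k) := by
  have h1 : ConvexOn ℝ (Ioi (0 : ℝ)) (fun k : ℝ => k ^ 2) :=
    (convexOn_pow 2).subset Ioi_subset_Ici_self (convex_Ioi 0)
  have h2 := (strictConcaveOn_log_Ioi.concaveOn.smul (zero_le_two : (0 : ℝ) ≤ 2)).neg
  have h3 := (h1.add h2).neg.add_const η
  refine h3.congr fun k _ => ?_
  simp [V]
  ring

/-- The function `V m - V` lies above its chord through the left root. -/
lemma chord_le_sub_V {m k b : ℝ} (hm : 0 < m) (hk : m ≤ k) (hkb : k ≤ b) (hmb : m < b) :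
    (V m - V b) / (b - m) * (k - m) ≤ V m - V k := by
  rcases hk.eq_or_lt with rfl | hk
  · simp
  rcases hkb.eq_or_lt with rfl | hkb
  · rw [div_mul_cancel₀ _ (sub_pos.2 hk).ne']
  have h := (concaveOn_sub_V (V m)).slope_anti_adjacent (mem_Ioi.2 hm)
    (mem_Ioi.2 (hm.trans hmb)) hk hkb
  simp only [sub_self, sub_zero] at h
  rw [div_le_div_iff₀ (by linarith) (by linarith)] at h
  rw [div_mul_eq_mul_div, div_le_iff₀ (by linarith)]
  nlinarith

lemma measurable_inv_sqrt_sub_V (η : ℝ) : Measurable fun k => (√(η - V k))⁻¹ := by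
  unfold V
  fun_prop

lemma intervalIntegrable_inv_sqrt_sub_V {m b : ℝ} (hm : 0 < m) (hmb : m < b)
    (hb : V b < V m) : IntervalIntegrable (fun k => (√(V m - V k))⁻¹) volume m b := by
  have hσ : 0 < (V m - V b) / (b - m) := div_pos (by linarith) (by linarith)
  have h := ((intervalIntegrable_rpow' (a := 0) (b := b - m) (r := -(1 / 2))
    (by norm_num)).comp_sub_right m).const_mul (√((V m - V b) / (b - m)))⁻¹
  simp only [zero_add, sub_add_cancel] at h
  refine h.mono_fun' (measurable_inv_sqrt_sub_V _).aestronglyMeasurable ?_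
  refine (ae_restrict_iff' measurableSet_uIoc).2 (Filter.Eventually.of_forall fun k hk => ?_)
  rw [uIoc_of_le hmb.le] at hk
  have hk' : 0 < k - m := by linarith [hk.1]
  have h1 := chord_le_sub_V hm hk.1.le hk.2 hmb
  dsimp only
  rw [Real.norm_of_nonneg (by positivity), Real.rpow_neg hk'.le, ← Real.sqrt_eq_rpow, ← mul_inv,
    ← Real.sqrt_mul hσ.le]
  exact inv_anti₀ (Real.sqrt_pos.2 (by positivity)) (Real.sqrt_le_sqrt h1)

lemma sqrt_pade_bound {y : ℝ} (hy : 0 ≤ y) : (1 + y / 2 + 3 * y ^ 2 / 8) ^ 2 * (1 - y) ≤ 1 := by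
  have h3 : 0 ≤ y ^ 3 := by positivity
  have h4 : 0 ≤ y ^ 4 := by positivity
  have h5 : 0 ≤ y ^ 5 := by positivity
  nlinarith

lemma le_inv_sqrt {x y : ℝ} (hy : 0 < y) (h : x ^ 2 * y ≤ 1) : x ≤ (√y)⁻¹ := by
  rw [← Real.sqrt_inv]
  refine Real.le_sqrt_of_sq_le ?_
  rw [← one_div, le_div_iff₀ hy]
  exact h

lemma le_integral_left {m x S μ : ℝ} (hm : 0 < m) (hm1 : m < 1) (hmx : m < x)
    (hS : S = (1 - m ^ 2) / 2) (hμ : μ = m ^ 2 / (2 * S)) (hx : log x = log m + S)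
    (hint : IntervalIntegrable (fun k => (√(V m - V k))⁻¹) volume m x)
    (hpos : ∀ k ∈ Ioo m x, 0 < V m - V k) :
    m * (1 + (1 + μ / 2) * S / 3 + (1 / 2 + μ / 2 + 3 * μ ^ 2 / 8) * S ^ 2 / 5) ≤
      ∫ k in m..x, (√(V m - V k))⁻¹ := by
  have hS0 : 0 < S := by rw [hS]; nlinarith
  have hμ0 : 0 < μ := by rw [hμ]; positivity
  have hμS : 2 * S * μ = m ^ 2 := by rw [hμ]; field_simp
  set α := 1 + μ / 2 with hα
  set β := 1 / 2 + μ / 2 + 3 * μ ^ 2 / 8 with hβ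
  have hα0 : 0 < α := by positivity
  have hβ0 : 0 < β := by positivity
  let s : ℝ → ℝ := fun k => log k - log m
  let G : ℝ → ℝ := fun k => m / √S * (√(s k) * (1 + α * s k / 3 + β * s k ^ 2 / 5))
  have hG := sub_le_integral_of_hasDeriv_right_of_le (g := G)
    (g' := fun k => m / (2 * √S) * ((1 + α * s k + β * s k ^ 2) / (√(s k) * k)))
    (φ := fun k => (√(V m - V k))⁻¹) hmx.le ?_ ?_
    ((intervalIntegrable_iff_integrableOn_Icc_of_le hmx.le).1 hint) ?_
  · refine le_trans (le_of_eq ?_) hG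
    have h1 : s x = S := by simp [s, hx]
    have h2 : s m = 0 := by simp [s]
    simp only [G, h1, h2, Real.sqrt_zero]
    have := Real.sqrt_pos.2 hS0
    field_simp
    ring
  · have hs : ContinuousOn s (Icc m x) := by
      refine ContinuousOn.sub (continuousOn_log.mono ?_) continuousOn_const
      intro k hk
      exact (hm.trans_le hk.1).ne'
    simp only [G]
    fun_prop
  · intro k hk
    have hk0 : 0 < k := hm.trans hk.1
    have hs0 : 0 < s k := sub_pos.2 (Real.log_lt_log hm hk.1)
    have hs : HasDerivAt s k⁻¹ k := (Real.hasDerivAt_log hk0.ne').sub_const _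
    have hd := (((hs.sqrt hs0.ne').mul
      ((((hs.const_mul α).div_const 3).const_add 1).add
        (((hs.pow 2).const_mul β).div_const 5))).const_mul (m / √S))
    refine (hd.congr_deriv ?_).hasDerivWithinAt
    have hq := Real.sqrt_pos.2 hs0
    have hq2 := Real.sq_sqrt hs0.le
    have hqS := Real.sqrt_pos.2 hS0
    simp only [Pi.pow_apply, Pi.add_apply]
    field_simp
    rw [hq2]
    ring
  · intro k hk
    have hk0 : 0 < k := hm.trans hk.1
    have hs0 : 0 < s k := sub_pos.2 (Real.log_lt_log hm hk.1)
    have hke : k = m * exp (s k) := by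
      simp only [s]
      rw [Real.exp_sub, Real.exp_log hk0, Real.exp_log hm]
      field_simp
    have hV : V m - V k = 2 * s k - m ^ 2 * (exp (2 * s k) - 1) := by
      have : exp (2 * s k) = exp (s k) ^ 2 := by rw [← Real.exp_nat_mul]; norm_num
      have h2 : k ^ 2 = m ^ 2 * exp (s k) ^ 2 := by nth_rw 1 [hke]; ring
      rw [this, V, V, h2]
      ring
    have he2 := Real.quadratic_le_exp_of_nonneg (x := 2 * s k) (by positivity)
    have he1 := Real.quadratic_le_exp_of_nonneg hs0.le
    have hf : V m - V k ≤ 4 * S * s k * (1 - μ * s k) := by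
      have : m ^ 2 * (2 * s k + 2 * s k ^ 2) ≤ m ^ 2 * (exp (2 * s k) - 1) := by
        gcongr; linarith
      rw [hV]
      have h1 : 1 - m ^ 2 = 2 * S := by rw [hS]; ring
      nlinarith
    have hpk := hpos k hk
    have hy : 0 < 1 - μ * s k := by
      by_contra! hneg
      nlinarith [mul_nonneg (mul_pos hS0 hs0).le (sub_nonneg.2 hneg)]
    refine le_inv_sqrt hpk ?_
    have hpade := sqrt_pade_bound (y := μ * s k) (by positivity)
    have hprod : 1 + α * s k + β * s k ^ 2 ≤
        exp (s k) * (1 + μ * s k / 2 + 3 * (μ * s k) ^ 2 / 8) := by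
      have : (1 + s k + s k ^ 2 / 2) * (1 + μ * s k / 2 + 3 * (μ * s k) ^ 2 / 8) ≤
        exp (s k) * (1 + μ * s k / 2 + 3 * (μ * s k) ^ 2 / 8) := by gcongr
      refine le_trans ?_ this
      have : 0 ≤ s k ^ 3 * (μ / 4 + 3 * μ ^ 2 / 8 + 3 * μ ^ 2 * s k / 16) := by positivity
      rw [hα, hβ]
      nlinarith
    have hsq : (m / (2 * √S) * ((1 + α * s k + β * s k ^ 2) / (√(s k) * k))) ^ 2 =
        (1 + α * s k + β * s k ^ 2) ^ 2 / (4 * S * s k * exp (s k) ^ 2) := by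
      nth_rw 4 [hke]
      rw [mul_pow, div_pow, div_pow, mul_pow, mul_pow, Real.sq_sqrt hS0.le, Real.sq_sqrt hs0.le]
      field_simp
      ring
    rw [hsq]
    calc _ ≤ (exp (s k) * (1 + μ * s k / 2 + 3 * (μ * s k) ^ 2 / 8)) ^ 2 /
          (4 * S * s k * exp (s k) ^ 2) * (4 * S * s k * (1 - μ * s k)) := by gcongr
      _ = (1 + μ * s k / 2 + 3 * (μ * s k) ^ 2 / 8) ^ 2 * (1 - μ * s k) := by
          field_simp
      _ ≤ 1 := hpade

lemma le_integral_right {c b T : ℝ} (hc : 1 < c) (hcb : 1 / c ≤ b)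
    (hb : (4 / 3) * b ^ 2 - 2 * log b = 1 + 2 * log c)
    (hT : T = 1 / c / √(1 - (1 / c) ^ 2))
    (hpos : ∀ k ∈ Icc (1 / c) b, 0 < (1 + 2 * log c) - V k) :
    π / 3 - arcsin (1 / c) + T / 2 * log (4 / 3 * b ^ 2) ≤
      ∫ k in (1 / c)..b, (√((1 + 2 * log c) - V k))⁻¹ := by
  have hc0 : 0 < c := by linarith
  have hx0 : 0 < 1 / c := by positivity
  have hx1 : 1 / c < 1 := by rw [div_lt_one hc0]; exact hc
  have hlx : log (1 / c) = - log c := by simp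
  have hb0 : 0 < b := hx0.trans_le hcb
  set η := 1 + 2 * log c with hη
  have hq : 0 < 1 - (1 / c) ^ 2 := by nlinarith
  have hT0 : 0 < T := by rw [hT]; positivity
  let f : ℝ → ℝ := fun k => η - V k
  have hfd : ∀ k, 0 < k → HasDerivAt f (-(2 * k - 2 * k⁻¹)) k := by
    intro k hk
    have h := ((hasDerivAt_pow 2 k).sub ((Real.hasDerivAt_log hk.ne').const_mul 2)).const_sub η
    refine h.congr_deriv ?_
    norm_num
  have hfc : ContinuousOn f (Icc (1 / c) b) := fun k hk =>
    (hfd k (hx0.trans_le hk.1)).continuousAt.continuousWithinAt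
  have hint : ContinuousOn (fun k => (√(f k))⁻¹) (Icc (1 / c) b) :=
    hfc.sqrt.inv₀ fun k hk => (Real.sqrt_pos.2 (hpos k hk)).ne'
  have hlog : ∀ k ∈ Icc (1 / c) b, 1 ≤ η + 2 * log k := by
    intro k hk
    have := Real.log_le_log hx0 hk.1
    rw [hη]; linarith
  let G : ℝ → ℝ := fun k => arctan (k / √(f k)) + T / 2 * log (η + 2 * log k)
  have hd : ∀ k ∈ Icc (1 / c) b, HasDerivAt G
      ((1 - 1 / (η + 2 * log k)) * (√(f k))⁻¹ + T * (1 / ((η + 2 * log k) * k))) k := by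
    intro k hk
    have hk0 := hx0.trans_le hk.1
    have hf0 : 0 < f k := hpos k hk
    have hl := hlog k hk
    have hr : η + 2 * log k = f k + k ^ 2 := by simp only [f, V]; ring
    have h1 := ((hasDerivAt_id k).div ((hfd k hk0).sqrt hf0.ne')
      (Real.sqrt_pos.2 hf0).ne').arctan
    have h2 := ((((Real.hasDerivAt_log hk0.ne').const_mul 2).const_add η).log
      (by linarith)).const_mul (T / 2)
    refine (h1.add h2).congr_deriv ?_
    have hq0 := Real.sqrt_pos.2 hf0
    have hq2 := Real.sq_sqrt hf0.le
    simp only [Pi.div_apply, id]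
    rw [hr]
    generalize √(f k) = q at *
    rw [← hq2]
    have : 0 < q ^ 2 + k ^ 2 := by positivity
    field_simp
    ring
  have hG := sub_le_integral_of_hasDeriv_right_of_le (g := G)
    (φ := fun k => (√(f k))⁻¹) hcb
    (fun k hk => (hd k hk).continuousAt.continuousWithinAt)
    (fun k hk => (hd k (Ioo_subset_Icc_self hk)).hasDerivWithinAt)
    (hint.integrableOn_Icc) ?_
  · refine le_trans (le_of_eq ?_) hG
    have h1 : f (1 / c) = 1 - (1 / c) ^ 2 := by
      simp only [f, V, hlx, hη]; ring
    have h2 : η + 2 * log (1 / c) = 1 := by rw [hlx, hη]; ring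
    have h3 : f b = b ^ 2 / 3 := by simp only [f, V]; linarith
    have h4 : η + 2 * log b = 4 / 3 * b ^ 2 := by linarith
    have h5 : b / √(b ^ 2 / 3) = √3 := by
      rw [Real.sqrt_div (by positivity), Real.sqrt_sq hb0.le]
      field_simp
    simp only [G, h1, h2, h3, h4, h5, Real.arctan_sqrt_three, Real.log_one]
    rw [Real.arcsin_eq_arctan (by constructor <;> linarith)]
    ring
  · intro k hk
    have hk' := Ioo_subset_Icc_self hk
    have hk0 := hx0.trans hk.1
    have hf0 : 0 < f k := hpos k hk'
    have hl := hlog k hk'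
    have key : T * (1 / k) ≤ (√(f k))⁻¹ := by
      refine le_inv_sqrt hf0 ?_
      have h1 : (c * k) ^ 2 ≥ η + 2 * log k := by
        have := Real.log_le_sub_one_of_pos (x := (c * k) ^ 2) (by positivity)
        rw [Real.log_pow, Real.log_mul hc0.ne' hk0.ne'] at this
        push_cast at this
        linarith
      have h2 : T ^ 2 = 1 / (c ^ 2 - 1) := by
        have : 0 < c ^ 2 - 1 := by nlinarith
        rw [hT, div_pow, Real.sq_sqrt hq.le]
        field_simp
      have h3 : 0 < c ^ 2 - 1 := by nlinarith
      rw [mul_pow, h2, div_pow, one_pow, div_mul_div_comm, div_mul_eq_mul_div, one_mul, one_mul,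
        div_le_one (by positivity)]
      simp only [f, V]
      nlinarith
    have : T * (1 / ((η + 2 * log k) * k)) ≤ 1 / (η + 2 * log k) * (√(f k))⁻¹ := by
      calc _ = 1 / (η + 2 * log k) * (T * (1 / k)) := by field_simp
        _ ≤ _ := by gcongr
    linarith

lemma exp_sub_self_le {a p : ℝ} (ha : 0 ≤ a) (hap : a ≤ p) : exp a - a ≤ exp p - p := by
  have h1 : exp p = exp a * exp (p - a) := by rw [← Real.exp_add]; ring_nf
  have h2 := Real.add_one_le_exp (p - a)
  have h3 := Real.one_le_exp ha
  nlinarith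

lemma exp_le_quartic {x : ℝ} (h0 : 0 ≤ x) (h1 : x ≤ 1) :
    exp x ≤ 1 + x + x ^ 2 / 2 + x ^ 3 / 6 + 5 * x ^ 4 / 96 := by
  refine (Real.exp_bound' h0 h1 (n := 4) (by norm_num)).trans (le_of_eq ?_)
  norm_num [Finset.sum_range_succ, Nat.factorial]
  ring

lemma quintic_le_exp {x : ℝ} (h0 : 0 ≤ x) :
    1 + x + x ^ 2 / 2 + x ^ 3 / 6 + x ^ 4 / 24 + x ^ 5 / 120 ≤ exp x := by
  refine (le_of_eq ?_).trans (Real.sum_le_exp_of_nonneg h0 6)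
  norm_num [Finset.sum_range_succ, Nat.factorial]

lemma log_four_thirds_lt : log (4 / 3) < 0.28769 := by
  rw [Real.log_lt_iff_lt_exp (by norm_num)]
  refine lt_of_lt_of_le ?_ (quintic_le_exp (by norm_num))
  norm_num

lemma log_decimal_lt : log 0.386 < -0.95 := by
  rw [Real.log_lt_iff_lt_exp (by norm_num)]
  have h : exp 0.95 < 1 / 0.386 := by
    have h1 := exp_le_quartic (x := 0.475) (by norm_num) (by norm_num)
    have h2 : exp 0.95 = exp 0.475 ^ 2 := by rw [← Real.exp_nat_mul]; norm_num
    have h3 : exp 0.475 ^ 2 ≤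
        (1 + 0.475 + 0.475 ^ 2 / 2 + 0.475 ^ 3 / 6 + 5 * 0.475 ^ 4 / 96) ^ 2 := by
      gcongr
    rw [h2]
    refine h3.trans_lt ?_
    norm_num
  rw [Real.exp_neg, lt_inv_comm₀ (by norm_num) (Real.exp_pos _)]
  simpa using h

lemma le_of_sub_log_le {x : ℝ} (hx : 0 < x) (h : x - log x ≤ 1.335) : 0.386 ≤ x := by
  by_contra! hlt
  have h1 := Real.log_le_sub_one_of_pos (x := x / 0.386) (by positivity)
  rw [Real.log_div hx.ne' (by norm_num)] at h1
  have h2 := log_decimal_lt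
  have h3 : x / 0.386 = x * (1 / 0.386) := by ring
  norm_num at *
  linarith

lemma arcsin_lt_add_tan {x : ℝ} (h1 : 0.8457 ≤ x) (h2 : x ≤ 0.86) :
    arcsin x < 0.847 * x + 0.1875 * (x / √(1 - x ^ 2)) := by
  rw [← Real.cos_arcsin]
  have hx : sin (arcsin x) = x := Real.sin_arcsin (by linarith) (by linarith)
  have hub := Real.arcsin_le_pi_div_two x
  have hlb := Real.neg_pi_div_two_le_arcsin x
  have hpi := Real.pi_lt_d4
  have hpi' := Real.pi_gt_three
  have h3 : √3 < 1.73206 := by rw [Real.sqrt_lt' (by norm_num)]; norm_num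
  have h3' : 1.732 < √3 := by rw [Real.lt_sqrt (by norm_num)]; norm_num
  obtain ⟨δ, hδ⟩ : ∃ δ, arcsin x = π / 3 - δ := ⟨π / 3 - arcsin x, by ring⟩
  have hδ0 : 0 ≤ δ := by
    by_contra! hneg
    have : sin (π / 3) < sin (arcsin x) := Real.strictMonoOn_sin
      ⟨by linarith, by linarith⟩ ⟨hlb, hub⟩ (by linarith)
    rw [hx, Real.sin_pi_div_three] at this
    linarith
  have hδ1 : δ ≤ 0.041 := by
    by_contra! hgt
    have : sin (arcsin x) < sin (π / 3 - 0.041) := Real.strictMonoOn_sin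
      ⟨hlb, hub⟩ ⟨by linarith, by linarith⟩ (by linarith)
    rw [hx, Real.sin_sub, Real.sin_pi_div_three, Real.cos_pi_div_three] at this
    have hs := Real.sin_gt_sub_cube (x := 0.041) (by norm_num)
    have hc := Real.cos_le_one 0.041
    norm_num at *
    nlinarith
  have hsin := Real.sin_le hδ0
  have hcos := Real.one_sub_sq_div_two_le_cos (x := δ)
  have hcos1 := Real.cos_le_one δ
  have hX : 0.866 - δ / 2 - 0.4331 * δ ^ 2 ≤ x := by
    rw [← hx, hδ, Real.sin_sub, Real.sin_pi_div_three, Real.cos_pi_div_three]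
    nlinarith [sq_nonneg δ]
  have hC : cos (arcsin x) ≤ 0.5 + 0.8661 * δ := by
    rw [hδ, Real.cos_sub, Real.sin_pi_div_three, Real.cos_pi_div_three]
    nlinarith
  have hC0 : 0 < cos (arcsin x) := by
    rw [Real.cos_arcsin]
    exact Real.sqrt_pos.2 (by nlinarith)
  have hX0 : 0 < 0.866 - δ / 2 - 0.4331 * δ ^ 2 := by nlinarith
  have hT : (0.866 - δ / 2 - 0.4331 * δ ^ 2) / (0.5 + 0.8661 * δ) ≤ x / cos (arcsin x) := by
    gcongr
  have hT' : 1.732 - 4.005 * δ ≤ (0.866 - δ / 2 - 0.4331 * δ ^ 2) / (0.5 + 0.8661 * δ) := by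
    rw [le_div_iff₀ (by positivity)]
    nlinarith [sq_nonneg δ]
  have : δ ^ 2 ≤ 0.041 * δ := by nlinarith
  rw [hδ] at *
  linarith

lemma lt_tan_add_sin {t : ℝ} (h0 : 0 < t) (h1 : t < π / 2) :
    t < 0.72 * sin t + 0.29 * tan t := by
  let H : ℝ → ℝ := fun y => 0.72 * sin y + 0.29 * tan y - y
  have hcos : ∀ y ∈ Ico 0 (π / 2), 0 < cos y := fun y hy =>
    Real.cos_pos_of_mem_Ioo ⟨by linarith [hy.1, Real.pi_pos], hy.2⟩
  have hd : ∀ y ∈ Ico 0 (π / 2), HasDerivAt H (0.72 * cos y + 0.29 * (1 / cos y ^ 2) - 1) y :=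
    fun y hy => (((Real.hasDerivAt_sin y).const_mul _).add
      ((Real.hasDerivAt_tan (hcos y hy).ne').const_mul _)).sub (hasDerivAt_id y)
  have hmono : StrictMonoOn H (Ico 0 (π / 2)) := by
    refine strictMonoOn_of_deriv_pos (convex_Ico _ _)
      (fun y hy => (hd y hy).continuousAt.continuousWithinAt) fun y hy => ?_
    have hy' := interior_subset hy
    have hc := hcos y hy'
    rw [(hd y hy').deriv]
    generalize cos y = u at hc
    have : 0.72 * u + 0.29 * (1 / u ^ 2) - 1 = (0.72 * u ^ 3 - u ^ 2 + 0.29) / u ^ 2 := by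
      field_simp
      ring
    rw [this]
    refine div_pos ?_ (by positivity)
    nlinarith [mul_nonneg hc.le (sq_nonneg (u - 0.9259)), sq_nonneg (u - 0.9259)]
  have h := hmono ⟨le_rfl, by positivity⟩ ⟨h0.le, h1⟩ h0
  simp only [H, Real.sin_zero, Real.tan_zero] at h
  linarith

lemma const_mul_exp_le_poly {S : ℝ} (h0 : 0 ≤ S) (h1 : S ≤ 1 / 2) :
    0.72 * exp S ≤ 1 + (S + (1 - 2 * S) / 4) / 3 +
      (S ^ 2 / 2 + S * (1 - 2 * S) / 4 + 3 * (1 - 2 * S) ^ 2 / 32) / 5 := by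
  have h := exp_le_quartic h0 (by linarith)
  have h2 : S ^ 2 ≤ S / 2 := by nlinarith
  have h3 : S ^ 3 ≤ S ^ 2 / 2 := by nlinarith [sq_nonneg S]
  have h4 : S ^ 4 ≤ S ^ 2 / 4 := by nlinarith [sq_nonneg S]
  nlinarith

lemma const_mul_exp_le_poly_of_le {S : ℝ} (h0 : 0 ≤ S) (h1 : S ≤ 0.307) :
    0.847 * exp S ≤ 1 + (S + (1 - 2 * S) / 4) / 3 +
      (S ^ 2 / 2 + S * (1 - 2 * S) / 4 + 3 * (1 - 2 * S) ^ 2 / 32) / 5 := by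
  have h := exp_le_quartic h0 (by linarith)
  have h2 : S ^ 2 ≤ 0.307 * S := by nlinarith
  have h3 : S ^ 3 ≤ 0.307 * S ^ 2 := by nlinarith [sq_nonneg S]
  have h4 : S ^ 4 ≤ 0.307 ^ 2 * S ^ 2 := by nlinarith [sq_nonneg S]
  nlinarith

lemma arcsin_lt_of_threshold {L m S A x T : ℝ} (hL : 0.15325 ≤ L) (hm : 0 < m) (hm1 : m < 1)
    (hS : S = (1 - m ^ 2) / 2) (hmL : m ^ 2 - 2 * log m = 1 + 2 * L)
    (hx : x = exp (-L)) (hxm : x = m * exp S)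
    (hA : 0 ≤ A) (hAL : exp A - A + log (4 / 3) = 1 + 2 * L) (hT : T = x / √(1 - x ^ 2)) :
    arcsin x < m * (1 + (S + (1 - 2 * S) / 4) / 3 +
      (S ^ 2 / 2 + S * (1 - 2 * S) / 4 + 3 * (1 - 2 * S) ^ 2 / 32) / 5) + A * T := by
  have hS0 : 0 ≤ S := by rw [hS]; nlinarith
  have hS1 : S ≤ 1 / 2 := by rw [hS]; nlinarith
  have hx0 : 0 < x := by rw [hx]; positivity
  have hx1 : x < 1 := by rw [hx]; exact Real.exp_lt_one_iff.2 (by linarith)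
  have hT0 : 0 < T := by
    rw [hT]
    have : 0 < 1 - x ^ 2 := by nlinarith
    positivity
  have h43 := log_four_thirds_lt
  rcases le_total L 0.1675 with hL1 | hL1
  · have hA' : 0.1875 ≤ A := by
      by_contra! hlt
      have h1 := exp_sub_self_le hA hlt.le
      have h2 := exp_le_quartic (x := 0.1875) (by norm_num) (by norm_num)
      norm_num at *
      linarith
    have hm2 : 0.386 ≤ m ^ 2 := by
      refine le_of_sub_log_le (by positivity) ?_
      rw [Real.log_pow]
      push_cast
      norm_num at *
      linarith
    have hQ := const_mul_exp_le_poly_of_le hS0 (by rw [hS]; linarith)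
    have hlo : 0.8457 ≤ x := by
      have h1 := exp_le_quartic (x := 0.1675) (by norm_num) (by norm_num)
      have h2 : exp L ≤ exp 0.1675 := Real.exp_le_exp.2 hL1
      rw [hx, Real.exp_neg, le_inv_comm₀ (by norm_num) (Real.exp_pos _)]
      refine (h2.trans h1).trans ?_
      norm_num
    have hhi : x ≤ 0.86 := by
      have h1 := quintic_le_exp (x := 0.15325) (by norm_num)
      have h2 : exp 0.15325 ≤ exp L := Real.exp_le_exp.2 hL
      rw [hx, Real.exp_neg, inv_le_comm₀ (Real.exp_pos _) (by norm_num)]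
      refine le_trans ?_ (h1.trans h2)
      norm_num
    have h := arcsin_lt_add_tan hlo hhi
    rw [← hT] at h
    have h1 := mul_le_mul_of_nonneg_left hQ hm.le
    have h2 := mul_le_mul_of_nonneg_right hA' hT0.le
    rw [hxm] at h ⊢
    linarith
  · have hA' : 0.29 ≤ A := by
      by_contra! hlt
      have h1 := exp_sub_self_le hA hlt.le
      have h2 := exp_le_quartic (x := 0.29) (by norm_num) (by norm_num)
      norm_num at *
      linarith
    have hQ := const_mul_exp_le_poly hS0 hS1
    have h := lt_tan_add_sin (Real.arcsin_pos.2 hx0) (Real.arcsin_lt_pi_div_two.2 hx1)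
    rw [Real.sin_arcsin (by linarith) hx1.le, Real.tan_arcsin, ← hT] at h
    have h1 := mul_le_mul_of_nonneg_left hQ hm.le
    have h2 := mul_le_mul_of_nonneg_right hA' hT0.le
    rw [hxm] at h ⊢
    linarith

theorem stmt_12 (kmin kA : ℝ → ℝ)
    (hkmin : ∀ η : ℝ, 1 < η → 0 < kmin η ∧ kmin η < 1 ∧ V (kmin η) = η)
    (hkA : ∀ η : ℝ, 1 + Real.log (4 / 3) ≤ η →
      Real.sqrt 3 / 2 ≤ kA η ∧ (4 / 3) * (kA η) ^ 2 - 2 * Real.log (kA η) = η)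
    (c : ℝ) (hc : Real.exp 0.15325 ≤ c) :
    (∫ k in (kmin (1 + 2 * Real.log c))..(kA (1 + 2 * Real.log c)),
        2 * (Real.sqrt ((1 + 2 * Real.log c) - V k))⁻¹) +
      2 * (∫ k in (1 / c)..(kA (1 + 2 * Real.log c)),
        (Real.sqrt ((1 + 2 * Real.log c) - V k))⁻¹) +
      2 * Real.arcsin (1 / c) - π / 3 > π := by
  have hc0 : 0 < c := (Real.exp_pos _).trans_le hc
  have hL : 0.15325 ≤ log c := (Real.le_log_iff_exp_le hc0).2 hc
  have h43 := log_four_thirds_lt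
  obtain ⟨hm, hm1, hVm⟩ := hkmin (1 + 2 * log c) (by norm_num at *; linarith)
  obtain ⟨hb, hbL⟩ := hkA (1 + 2 * log c) (by norm_num at *; linarith)
  generalize kmin (1 + 2 * log c) = m at *
  generalize kA (1 + 2 * log c) = b at *
  have hb0 : 0 < b := lt_of_lt_of_le (by positivity) hb
  have hc1 : 1 < c := by
    rw [← Real.log_pos_iff hc0.le]; norm_num at *; linarith
  obtain ⟨S, hS⟩ : ∃ S, S = (1 - m ^ 2) / 2 := ⟨_, rfl⟩
  have hS0 : 0 < S := by rw [hS]; nlinarith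
  have hmL : m ^ 2 - 2 * log m = 1 + 2 * log c := hVm
  have hlx : log (1 / c) = log m + S := by
    rw [one_div, Real.log_inv, hS]; linarith
  have hx0 : 0 < 1 / c := by positivity
  have hxm : 1 / c = m * exp S := by
    rw [← Real.exp_log hx0, hlx, Real.exp_add, Real.exp_log hm]
  have hmx : m < 1 / c := by
    rw [hxm]; nlinarith [Real.one_lt_exp_iff.2 hS0]
  have hb34 : 3 / 4 ≤ b ^ 2 := by
    have := pow_le_pow_left₀ (by positivity) hb 2
    rw [div_pow, Real.sq_sqrt (by norm_num)] at this
    norm_num at this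
    exact this
  have hxb : 1 / c ≤ b := by
    have h1 := quintic_le_exp (x := 0.15325) (by norm_num)
    have h2 : 1.16 ≤ c := by
      refine le_trans ?_ (h1.trans hc)
      norm_num
    rw [div_le_iff₀ hc0]
    have : 1 ^ 2 ≤ (b * c) ^ 2 := by rw [mul_pow]; nlinarith
    exact le_of_sq_le_sq this (by positivity)
  have hVb : V b < V m := by
    rw [hVm, V]; nlinarith
  have hmb := hmx.trans_le hxb
  have hpos : ∀ k, m < k → k ≤ b → 0 < V m - V k := fun k h1 h2 =>
    (mul_pos (div_pos (sub_pos.2 hVb) (sub_pos.2 hmb)) (sub_pos.2 h1)).trans_le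
      (chord_le_sub_V hm h1.le h2 hmb)
  have hint := intervalIntegrable_inv_sqrt_sub_V hm hmb hVb
  have hint1 := hint.mono_set (c := m) (d := 1 / c)
    (by rw [uIcc_of_le hmx.le, uIcc_of_le hmb.le]; exact Icc_subset_Icc_right hxb)
  have hint2 := hint.mono_set (c := 1 / c) (d := b)
    (by rw [uIcc_of_le hxb, uIcc_of_le hmb.le]; exact Icc_subset_Icc_left hmx.le)
  have hleft := le_integral_left hm hm1 hmx hS rfl hlx hint1
    fun k hk => hpos k hk.1 (hk.2.le.trans hxb)
  have hright := le_integral_right hc1 hxb hbL rfl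
    fun k hk => by rw [← hVm]; exact hpos k (hmx.trans_le hk.1) hk.2
  have hnum := arcsin_lt_of_threshold hL hm hm1 hS hmL (x := 1 / c)
    (by rw [Real.exp_neg, Real.exp_log hc0, one_div]) hxm (A := log (4 / 3 * b ^ 2))
    (Real.log_nonneg (by linarith))
    (by
      rw [Real.exp_log (by positivity), Real.log_mul (by norm_num) (by positivity), Real.log_pow]
      push_cast
      linarith) rfl
  have hQ : m * (1 + (1 + m ^ 2 / (2 * S) / 2) * S / 3 +
      (1 / 2 + m ^ 2 / (2 * S) / 2 + 3 * (m ^ 2 / (2 * S)) ^ 2 / 8) * S ^ 2 / 5) =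
      m * (1 + (S + (1 - 2 * S) / 4) / 3 +
      (S ^ 2 / 2 + S * (1 - 2 * S) / 4 + 3 * (1 - 2 * S) ^ 2 / 32) / 5) := by
    have : 1 - 2 * S = m ^ 2 := by rw [hS]; ring
    rw [this]
    field_simp
    ring
  rw [hQ] at hleft
  rw [intervalIntegral.integral_const_mul, ← hVm]
  rw [← hVm] at hright
  rw [← integral_add_adjacent_intervals hint1 hint2]
  linarith
end
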